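/- Let p ∈ (0,1), λ > 0, and let n be a nonzero vector in a finite-dimensional real inner product space (e.g. ℝ^d). Then u* is a global minimizer of F(u) = λ‖u‖^p + (1/2)‖u − n‖^2 if and only if u* = t·(n/‖n‖) for some t ∈ ℝ that is a global minimizer of the scalar problem f(t) = λ|t|^p + (1/2)(t − ‖n‖)^2. In particular every minimizer of F is a nonnegative multiple of n. -/

import Mathlib

lemma sq_norm_sub_norm_le {E : Type*} [SeminormedAddCommGroup E] (v n : E) :
    (‖v‖ - ‖n‖) ^ 2 ≤ ‖v - n‖ ^ 2 :=
  sq_le_sq' (neg_le_of_abs_le (abs_norm_sub_norm_le v n)) (norm_sub_norm_le v n)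

section

variable {E : Type*} [NormedAddCommGroup E] [InnerProductSpace ℝ E]

lemma norm_smul_normalize {n : E} (hn : n ≠ 0) (t : ℝ) : ‖t • (‖n‖⁻¹ • n)‖ = |t| := by
  rw [norm_smul, norm_smul, norm_inv, norm_norm, inv_mul_cancel₀ (norm_ne_zero_iff.2 hn),
    mul_one, Real.norm_eq_abs]

lemma norm_smul_normalize_sub_sq {n : E} (hn : n ≠ 0) (t : ℝ) :
    ‖t • (‖n‖⁻¹ • n) - n‖ ^ 2 = (t - ‖n‖) ^ 2 := by
  have h : t • (‖n‖⁻¹ • n) - n = (t - ‖n‖) • (‖n‖⁻¹ • n) := by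
    rw [sub_smul, smul_inv_smul₀ (norm_ne_zero_iff.2 hn)]
  rw [h, norm_smul_normalize hn, sq_abs]

/-- The equality case of the reverse triangle inequality. -/
lemma eq_norm_smul_normalize_of_norm_sub_sq_le {u n : E} (hn : n ≠ 0)
    (h : ‖u - n‖ ^ 2 ≤ (‖u‖ - ‖n‖) ^ 2) : u = ‖u‖ • (‖n‖⁻¹ • n) := by
  have hinner : inner ℝ u n = ‖u‖ * ‖n‖ := by
    have := norm_sub_sq_real u n
    have := real_inner_le_norm u n
    nlinarith
  rw [smul_comm, ← inner_eq_norm_mul_iff_real.1 hinner, inv_smul_smul₀ (norm_ne_zero_iff.2 hn)]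

/-- A minimizer of a radial function plus the squared distance to `n` points in the direction
of `n`. -/
lemma eq_norm_smul_normalize_of_forall_le {φ : ℝ → ℝ} {u n : E} (hn : n ≠ 0)
    (hu : ∀ v : E, φ ‖u‖ + (1 / 2) * ‖u - n‖ ^ 2 ≤ φ ‖v‖ + (1 / 2) * ‖v - n‖ ^ 2) :
    u = ‖u‖ • (‖n‖⁻¹ • n) := by
  refine eq_norm_smul_normalize_of_norm_sub_sq_le hn ?_
  have := hu (‖u‖ • (‖n‖⁻¹ • n))
  rw [norm_smul_normalize hn, norm_smul_normalize_sub_sq hn, abs_norm] at this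
  linarith

end

/-- For `p ∈ (0,1)`, `λ > 0` and a nonzero vector `n` in a finite-dimensional real
inner product space, `u*` is a global minimizer of
`F(u) = λ‖u‖^p + (1/2)‖u − n‖^2` iff `u* = t·(n/‖n‖)` for some `t` minimizing the
scalar problem `f(t) = λ|t|^p + (1/2)(t − ‖n‖)^2`; in particular every minimizer
of `F` is a nonnegative multiple of `n`. -/
theorem group_lp_prox_reduction {E : Type*} [NormedAddCommGroup E] [InnerProductSpace ℝ E]
    [FiniteDimensional ℝ E] (p lam : ℝ) (hp0 : 0 < p) (hp1 : p < 1) (hlam : 0 < lam)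
    (n : E) (hn : n ≠ 0) :
    (∀ ustar : E,
      (∀ v : E,
        lam * ‖ustar‖ ^ p + (1 / 2) * ‖ustar - n‖ ^ 2 ≤
          lam * ‖v‖ ^ p + (1 / 2) * ‖v - n‖ ^ 2) ↔
      ∃ t : ℝ, ustar = t • (‖n‖⁻¹ • n) ∧
        ∀ s : ℝ,
          lam * |t| ^ p + (1 / 2) * (t - ‖n‖) ^ 2 ≤
            lam * |s| ^ p + (1 / 2) * (s - ‖n‖) ^ 2) ∧
    (∀ ustar : E,
      (∀ v : E,
        lam * ‖ustar‖ ^ p + (1 / 2) * ‖ustar - n‖ ^ 2 ≤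
          lam * ‖v‖ ^ p + (1 / 2) * ‖v - n‖ ^ 2) →
      ∃ c : ℝ, 0 ≤ c ∧ ustar = c • n) := by
  have direction (u : E) (hu : ∀ v : E, lam * ‖u‖ ^ p + (1 / 2) * ‖u - n‖ ^ 2 ≤
      lam * ‖v‖ ^ p + (1 / 2) * ‖v - n‖ ^ 2) : u = ‖u‖ • (‖n‖⁻¹ • n) :=
    eq_norm_smul_normalize_of_forall_le (φ := fun r => lam * r ^ p) hn hu
  refine ⟨fun u => ⟨fun hu => ⟨‖u‖, direction u hu, fun s => ?_⟩, ?_⟩, fun u hu => ?_⟩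
  · have hs := hu (s • (‖n‖⁻¹ • n))
    rw [norm_smul_normalize hn, norm_smul_normalize_sub_sq hn] at hs
    rw [abs_norm]
    linarith [sq_norm_sub_norm_le u n]
  · rintro ⟨t, rfl, ht⟩ v
    have hv := ht ‖v‖
    rw [abs_norm] at hv
    rw [norm_smul_normalize hn, norm_smul_normalize_sub_sq hn]
    linarith [sq_norm_sub_norm_le v n]
  · exact ⟨‖u‖ * ‖n‖⁻¹, by positivity, by rw [mul_smul]; exact direction u hu⟩
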